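/- For pool, local linearizability is incomparable to sequential consistency: (i) there exists a concurrent history over Σ_P that is sequentially consistent with respect to S_P but not locally linearizable with respect to S_P; and (ii) there exists a concurrent history over Σ_P that is locally linearizable with respect to S_P but not sequentially consistent with respect to S_P. -/

import Mathlib

namespace LL

universe u v w

/-- Method calls of a container alphabet: insertions `ins x` of a value `x ∈ V`,
and removals `rem v` of a value `v ∈ V` or returning an "empty" value in `E`. -/
inductive CMethod (V : Type u) (E : Type v) where
  | ins : V → CMethod V E
  | rem : V ⊕ E → CMethod V E

/-- Events of a concurrent history: invocations and responses of method calls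
in `σ`, tagged with a thread identifier in `I`. -/
inductive Event (σ : Type u) (I : Type v) where
  | inv : σ → I → Event σ I
  | res : σ → I → Event σ I

variable {σ : Type*} {I : Type*} {V : Type*} {E : Type*} {α : Type*}

/-- The method call of an event. -/
def Event.method : Event σ I → σ
  | .inv m _ => m
  | .res m _ => m

/-- The thread identifier of an event. -/
def Event.thread : Event σ I → I
  | .inv _ k => k
  | .res _ k => k

/-- Whether an event is an invocation. -/
def Event.isInv : Event σ I → Bool
  | .inv _ _ => true
  | .res _ _ => false

/-- `a` occurs (strictly) before `b` in the sequence `s`. -/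
def OccursBefore (s : List α) (a b : α) : Prop :=
  ∃ i j : Fin s.length, i < j ∧ s.get i = a ∧ s.get j = b

/-- A set of sequences is prefix-closed. -/
def PrefixClosed (S : Set (List α)) : Prop :=
  ∀ s ∈ S, ∀ t : List α, t <+: s → t ∈ S

open Classical in
/-- The subsequence of events of thread `k`. -/
noncomputable def threadEvents (h : List (Event σ I)) (k : I) : List (Event σ I) :=
  h.filter fun e => decide (e.thread = k)

/-- `h` is a well-formed concurrent history: no event occurs twice, each method
call is invoked at most once, every response is preceded by its matching
invocation, and in every thread's subsequence of events each invocation is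
immediately followed by its matching response. -/
structure IsHistory (h : List (Event σ I)) : Prop where
  nodup : h.Nodup
  invUnique : ∀ (i j : Fin h.length) (m : σ) (k k' : I),
      h.get i = Event.inv m k → h.get j = Event.inv m k' → i = j
  resMatched : ∀ (j : Fin h.length) (m : σ) (k : I), h.get j = Event.res m k →
      ∃ i : Fin h.length, i < j ∧ h.get i = Event.inv m k
  threadSeq : ∀ (k : I) (i : ℕ) (m : σ),
      (threadEvents h k)[i]? = some (Event.inv m k) →
      ∀ e : Event σ I, (threadEvents h k)[i + 1]? = some e → e = Event.res m k

/-- The method call `m` appears in `h` (its invocation occurs in `h`). -/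
def Appears (h : List (Event σ I)) (m : σ) : Prop :=
  ∃ k : I, Event.inv m k ∈ h

/-- `h` is complete: every invocation has its matching response in `h`. -/
def HistComplete (h : List (Event σ I)) : Prop :=
  ∀ (m : σ) (k : I), Event.inv m k ∈ h → Event.res m k ∈ h

/-- The method call `m` (executed by thread `k`) is pending in `h`. -/
def PendingCall (h : List (Event σ I)) (m : σ) (k : I) : Prop :=
  Event.inv m k ∈ h ∧ Event.res m k ∉ h

/-- `hc` is a completion of `h`: a complete well-formed history obtained from `h`
by deleting some pending invocations and appending matching responses for the
remaining pending invocations. -/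
def IsCompletionOf (hc h : List (Event σ I)) : Prop :=
  IsHistory hc ∧ HistComplete hc ∧
  ∃ h' r : List (Event σ I),
    h'.Sublist h ∧
    (∀ e ∈ h, e ∉ h' → ∃ (m : σ) (k : I), e = Event.inv m k ∧ PendingCall h m k) ∧
    (∀ e ∈ r, ∃ (m : σ) (k : I), e = Event.res m k ∧ PendingCall h m k) ∧
    hc = h' ++ r

/-- The precedence order of `h`: `m <_h n` iff the response of `m` occurs in `h`
before the invocation of `n`. -/
def Precedes (h : List (Event σ I)) (m n : σ) : Prop :=
  ∃ (i j : Fin h.length) (k k' : I),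
    i < j ∧ h.get i = Event.res m k ∧ h.get j = Event.inv n k'

/-- The sequence of method calls of a history (in invocation order). -/
def methodList (h : List (Event σ I)) : List σ :=
  (h.filter Event.isInv).map Event.method

/-- `h` is linearizable wrt the sequential specification `S`. -/
def Linearizable (S : Set (List σ)) (h : List (Event σ I)) : Prop :=
  ∃ hc : List (Event σ I), IsCompletionOf hc h ∧
    ∃ s ∈ S, s.Perm (methodList hc) ∧
      ∀ m n : σ, Precedes hc m n → OccursBefore s m n

/-- `h` is sequentially consistent wrt `S`. -/
def SeqConsistent (S : Set (List σ)) (h : List (Event σ I)) : Prop :=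
  ∃ hc : List (Event σ I), IsCompletionOf hc h ∧
    ∃ s ∈ S, s.Perm (methodList hc) ∧
      ∀ m n : σ, Precedes hc m n →
        (∃ k : I, Event.inv m k ∈ hc ∧ Event.inv n k ∈ hc) →
        OccursBefore s m n

/-- Position `p` is a quiescent state of `h`: every invocation occurring before
position `p` has its matching response before position `p`. -/
def QuiescentAt (h : List (Event σ I)) (p : ℕ) : Prop :=
  ∀ (i : Fin h.length) (m : σ) (k : I), (i : ℕ) < p → h.get i = Event.inv m k →
    ∃ j : Fin h.length, (j : ℕ) < p ∧ h.get j = Event.res m k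

/-- `h` is quiescently consistent wrt `S`. -/
def QuiescentConsistent (S : Set (List σ)) (h : List (Event σ I)) : Prop :=
  ∃ hc : List (Event σ I), IsCompletionOf hc h ∧
    ∃ s ∈ S, s.Perm (methodList hc) ∧
      ∀ m n : σ,
        (∃ p : ℕ, QuiescentAt hc p ∧
          (∃ (i : Fin hc.length) (k : I), (i : ℕ) < p ∧ hc.get i = Event.res m k) ∧
          (∃ (j : Fin hc.length) (k : I), p ≤ (j : ℕ) ∧ hc.get j = Event.inv n k)) →
        OccursBefore s m n

/-- Membership of a method call in `I_T ∪ O_T`: insertions performed by thread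
`T` in `h`, removals of values inserted by `T` in `h`, and removals returning an
"empty" value. -/
def InducedMethod (h : List (Event (CMethod V E) I)) (T : I) : CMethod V E → Prop
  | .ins x => Event.inv (CMethod.ins x) T ∈ h
  | .rem (Sum.inl x) => Event.inv (CMethod.ins x) T ∈ h
  | .rem (Sum.inr _) => True

open Classical in
/-- The thread-induced history `h_T`: the subsequence of `h` of events of method
calls in `I_T ∪ O_T`. -/
noncomputable def threadInduced (h : List (Event (CMethod V E) I)) (T : I) :
    List (Event (CMethod V E) I) :=
  h.filter fun e => decide (InducedMethod h T e.method)

/-- `h` is locally linearizable wrt `S`: every thread-induced history is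
linearizable wrt `S`, and the thread-induced histories decompose `h`. -/
def LocallyLinearizable (S : Set (List (CMethod V E)))
    (h : List (Event (CMethod V E) I)) : Prop :=
  (∀ T : I, Linearizable S (threadInduced h T)) ∧
  (∀ m : CMethod V E, Appears h m → ∃ T : I, InducedMethod h T m)

/-- The pool sequential specification `S_P`. -/
def poolSpec (V : Type u) (E : Type v) : Set (List (CMethod V E)) :=
  { s | s.Nodup ∧
    (∀ x : V, CMethod.rem (Sum.inl x) ∈ s →
      CMethod.ins x ∈ s ∧
      OccursBefore s (CMethod.ins x) (CMethod.rem (Sum.inl x))) ∧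
    (∀ (e : E) (x : V),
      OccursBefore s (CMethod.ins x) (CMethod.rem (Sum.inr e)) →
      CMethod.rem (Sum.inl x) ∈ s ∧
      OccursBefore s (CMethod.rem (Sum.inl x)) (CMethod.rem (Sum.inr e))) }

/-- The queue sequential specification `S_Q` (pool axioms plus queue order). -/
def queueSpec (V : Type u) (E : Type v) : Set (List (CMethod V E)) :=
  { s | s ∈ poolSpec V E ∧
    ∀ x y : V, OccursBefore s (CMethod.ins x) (CMethod.ins y) →
      CMethod.rem (Sum.inl y) ∈ s →
      CMethod.rem (Sum.inl x) ∈ s ∧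
      OccursBefore s (CMethod.rem (Sum.inl x)) (CMethod.rem (Sum.inl y)) }

/-- The stack sequential specification `S_S` (pool axioms plus stack order). -/
def stackSpec (V : Type u) (E : Type v) : Set (List (CMethod V E)) :=
  { s | s ∈ poolSpec V E ∧
    ∀ x y : V, OccursBefore s (CMethod.ins x) (CMethod.ins y) →
      OccursBefore s (CMethod.ins y) (CMethod.rem (Sum.inl x)) →
      CMethod.rem (Sum.inl y) ∈ s ∧
      OccursBefore s (CMethod.rem (Sum.inl y)) (CMethod.rem (Sum.inl x)) }

/-- A method call's value lies in `V' ∪ Emp`. -/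
def ProjKeep (V' : Set V) : CMethod V E → Prop
  | .ins x => x ∈ V'
  | .rem (Sum.inl x) => x ∈ V'
  | .rem (Sum.inr _) => True

open Classical in
/-- The data-projection of a sequence: the subsequence of method calls whose
value lies in `V' ∪ Emp`. -/
noncomputable def dataProj (V' : Set V) (s : List (CMethod V E)) :
    List (CMethod V E) :=
  s.filter fun m => decide (ProjKeep V' m)

/-- `S` is closed under data-projection. -/
def ClosedUnderDataProjection (S : Set (List (CMethod V E))) : Prop :=
  ∀ s ∈ S, ∀ V' : Set V, dataProj V' s ∈ S

end LL

namespace LL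

/-! ### Reduction of the positional notions to recursion on lists -/

section Lists

variable {σ I α : Type*}

@[simp] theorem not_occursBefore_nil (a b : α) : ¬ OccursBefore [] a b := by
  rintro ⟨i, -⟩
  exact i.elim0

@[simp] theorem occursBefore_cons (c : α) (s : List α) (a b : α) :
    OccursBefore (c :: s) a b ↔ (c = a ∧ b ∈ s) ∨ OccursBefore s a b := by
  constructor
  · rintro ⟨i, j, hij, hi, hj⟩
    obtain ⟨j, rfl⟩ := Fin.exists_succ_eq.mpr (Fin.ne_zero_of_lt hij)
    induction i using Fin.cases with
    | zero => exact Or.inl ⟨hi, hj ▸ List.get_mem s j⟩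
    | succ i => exact Or.inr ⟨i, j, Fin.succ_lt_succ_iff.mp hij, hi, hj⟩
  · rintro (⟨rfl, hb⟩ | ⟨i, j, hij, hi, hj⟩)
    · obtain ⟨j, rfl⟩ := List.get_of_mem hb
      exact ⟨0, j.succ, Fin.succ_pos j, rfl, rfl⟩
    · exact ⟨i.succ, j.succ, Fin.succ_lt_succ_iff.mpr hij, hi, hj⟩

theorem OccursBefore.asymm {s : List α} (hs : s.Nodup) {a b : α} (hab : OccursBefore s a b) :
    ¬ OccursBefore s b a := by
  obtain ⟨i, j, hij, rfl, rfl⟩ := hab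
  rintro ⟨i', j', hij', hi', hj'⟩
  rw [List.nodup_iff_injective_get.mp hs hi', List.nodup_iff_injective_get.mp hs hj'] at hij'
  exact lt_asymm hij hij'

theorem OccursBefore.trans {s : List α} (hs : s.Nodup) {a b c : α} (hab : OccursBefore s a b)
    (hbc : OccursBefore s b c) : OccursBefore s a c := by
  obtain ⟨i, j, hij, rfl, rfl⟩ := hab
  obtain ⟨i', j', hij', hi', rfl⟩ := hbc
  rw [List.nodup_iff_injective_get.mp hs hi'] at hij'
  exact ⟨i, j', hij.trans hij', rfl, rfl⟩

theorem precedes_iff {h : List (Event σ I)} {m n : σ} :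
    Precedes h m n ↔ ∃ k k', OccursBefore h (Event.res m k) (Event.inv n k') := by
  constructor
  · rintro ⟨i, j, k, k', hij⟩
    exact ⟨k, k', i, j, hij⟩
  · rintro ⟨k, k', i, j, hij⟩
    exact ⟨i, j, k, k', hij⟩

@[simp] theorem methodList_nil : methodList ([] : List (Event σ I)) = [] := rfl

@[simp] theorem methodList_cons_inv (m : σ) (k : I) (h : List (Event σ I)) :
    methodList (.inv m k :: h) = m :: methodList h := rfl

@[simp] theorem methodList_cons_res (m : σ) (k : I) (h : List (Event σ I)) :
    methodList (.res m k :: h) = methodList h := rfl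

theorem isHistory_of_list {h : List (Event σ I)} (hnd : h.Nodup) (hm : (methodList h).Nodup)
    (hres : ∀ m k, Event.res m k ∈ h → OccursBefore h (Event.inv m k) (Event.res m k))
    (hthr : ∀ k, (threadEvents h k).IsChain
      fun a b => ∀ m, a = Event.inv m k → b = Event.res m k) :
    IsHistory h where
  nodup := hnd
  invUnique i j m k k' hi hj := by
    have hinj := List.inj_on_of_nodup_map hm
    have hinv : Event.inv m k = Event.inv m k' :=
      hinj (List.mem_filter.mpr ⟨hi ▸ List.get_mem h i, rfl⟩)
        (List.mem_filter.mpr ⟨hj ▸ List.get_mem h j, rfl⟩) rfl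
    exact List.nodup_iff_injective_get.mp hnd (hi.trans (hinv.trans hj.symm))
  resMatched j m k hj := by
    obtain ⟨i, j', hij, hi, hj'⟩ := hres m k (hj ▸ List.get_mem h j)
    rw [List.nodup_iff_injective_get.mp hnd (hj'.trans hj.symm)] at hij
    exact ⟨i, hij, hi⟩
  threadSeq k i m hi e he := by
    obtain ⟨hi', hi⟩ := List.getElem?_eq_some_iff.mp hi
    obtain ⟨he', he⟩ := List.getElem?_eq_some_iff.mp he
    rw [← he]
    exact List.isChain_iff_getElem.mp (hthr k) i he' m hi

theorem isCompletionOf_self {h : List (Event σ I)} (hh : IsHistory h) (hc : HistComplete h) :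
    IsCompletionOf h h :=
  ⟨hh, hc, h, [], List.Sublist.refl h, fun _ he hn => absurd he hn, by simp, by simp⟩

theorem IsCompletionOf.eq_of_histComplete {h hc : List (Event σ I)} (hcomp : IsCompletionOf hc h)
    (hh : h.Nodup) (hcl : HistComplete h) : hc = h := by
  obtain ⟨-, -, h', r, hsub, hdel, happ, rfl⟩ := hcomp
  have hnp : ∀ m k, ¬ PendingCall h m k := fun m k hp => hp.2 (hcl m k hp.1)
  have hr : r = [] := List.eq_nil_iff_forall_not_mem.mpr fun e he => by
    obtain ⟨m, k, -, hp⟩ := happ e he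
    exact hnp m k hp
  have hmem : h ⊆ h' := fun e he => by
    by_contra hn
    obtain ⟨m, k, -, hp⟩ := hdel e he hn
    exact hnp m k hp
  rw [hr, List.append_nil]
  exact hsub.eq_of_length_le (hh.subperm hmem).length_le

/-- On a complete history, the history itself can be used as the completion. -/
theorem linearizable_of_histComplete {S : Set (List σ)} {h : List (Event σ I)}
    (hh : IsHistory h) (hc : HistComplete h) {s : List σ} (hs : s ∈ S)
    (hp : s.Perm (methodList h))
    (ho : ∀ m n k k', OccursBefore h (Event.res m k) (Event.inv n k') → OccursBefore s m n) :
    Linearizable S h :=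
  ⟨h, isCompletionOf_self hh hc, s, hs, hp, fun m n hmn => by
    obtain ⟨k, k', hmn⟩ := precedes_iff.mp hmn
    exact ho m n k k' hmn⟩

end Lists

section Induced

variable {V E I : Type*} (h : List (Event (CMethod V E) I)) (T : I)

@[simp] theorem method_inv {σ : Type*} (m : σ) (k : I) : (Event.inv m k).method = m := rfl

@[simp] theorem method_res {σ : Type*} (m : σ) (k : I) : (Event.res m k).method = m := rfl

@[simp] theorem inducedMethod_ins (x : V) :
    InducedMethod h T (.ins x) ↔ Event.inv (CMethod.ins x) T ∈ h := Iff.rfl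

@[simp] theorem inducedMethod_rem_inl (x : V) :
    InducedMethod h T (.rem (.inl x)) ↔ Event.inv (CMethod.ins x) T ∈ h := Iff.rfl

@[simp] theorem inducedMethod_rem_inr (e : E) : InducedMethod h T (.rem (.inr e)) := trivial

end Induced

/-! ### A removal completed before its insertion -/

section RemoveBeforeInsert

variable {V E I : Type*}

/-- `T₂` removes `x`, and only then `T₁` inserts it. -/
def removeBeforeInsert (E : Type*) (x : V) (T₁ T₂ : I) : List (Event (CMethod V E) I) :=
  [.inv (.rem (.inl x)) T₂, .res (.rem (.inl x)) T₂, .inv (.ins x) T₁, .res (.ins x) T₁]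

variable (E) (x : V) {T₁ T₂ : I}

theorem isHistory_removeBeforeInsert (hT : T₁ ≠ T₂) :
    IsHistory (removeBeforeInsert E x T₁ T₂) := by
  apply isHistory_of_list
  · simp [removeBeforeInsert]
  · simp [removeBeforeInsert]
  · simp only [removeBeforeInsert, occursBefore_cons, not_occursBefore_nil, List.mem_cons]
    grind
  · intro k
    by_cases h₁ : T₁ = k <;> by_cases h₂ : T₂ = k <;>
      simp_all [removeBeforeInsert, threadEvents, Event.thread]

theorem histComplete_removeBeforeInsert (T₁ T₂ : I) :
    HistComplete (removeBeforeInsert E x T₁ T₂) := by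
  simp only [HistComplete, removeBeforeInsert]
  grind

theorem seqConsistent_removeBeforeInsert (hT : T₁ ≠ T₂) :
    SeqConsistent (poolSpec V E) (removeBeforeInsert E x T₁ T₂) := by
  refine ⟨_, isCompletionOf_self (isHistory_removeBeforeInsert E x hT)
    (histComplete_removeBeforeInsert E x T₁ T₂), [.ins x, .rem (.inl x)], ?_, ?_, ?_⟩
  · simp [poolSpec]
  · simpa [removeBeforeInsert] using List.Perm.swap _ _ _
  · rintro m n hmn ⟨k, hm, hn⟩
    obtain ⟨k₁, k₂, hmn⟩ := precedes_iff.mp hmn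
    simp only [removeBeforeInsert, occursBefore_cons, not_occursBefore_nil] at *
    grind

theorem threadInduced_removeBeforeInsert (T₁ T₂ : I) :
    threadInduced (removeBeforeInsert E x T₁ T₂) T₁ = removeBeforeInsert E x T₁ T₂ := by
  simp [threadInduced, removeBeforeInsert]

theorem not_locallyLinearizable_removeBeforeInsert (hT : T₁ ≠ T₂) :
    ¬ LocallyLinearizable (poolSpec V E) (removeBeforeInsert E x T₁ T₂) := by
  rintro ⟨hlin, -⟩
  specialize hlin T₁
  rw [threadInduced_removeBeforeInsert] at hlin
  obtain ⟨hc, hcomp, s, ⟨hnd, hrem, -⟩, hp, ho⟩ := hlin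
  obtain rfl := hcomp.eq_of_histComplete (isHistory_removeBeforeInsert E x hT).nodup
    (histComplete_removeBeforeInsert E x T₁ T₂)
  have hmem : CMethod.rem (Sum.inl x) ∈ s := by
    simp [hp.mem_iff, removeBeforeInsert]
  refine (hrem x hmem).2.asymm hnd (ho _ _ (precedes_iff.mpr ⟨T₂, T₁, ?_⟩))
  simp [removeBeforeInsert]

end RemoveBeforeInsert

/-! ### An empty removal seeing different states per inserting thread -/

section EmptyRemoval

variable {V E I : Type*}

/-- `T₁` inserts `x` and then runs a removal returning `e`, during which `T₂` inserts `y` and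
then removes `x`. -/
def overlappedEmptyRemoval (x y : V) (e : E) (T₁ T₂ : I) : List (Event (CMethod V E) I) :=
  [.inv (.ins x) T₁, .res (.ins x) T₁, .inv (.rem (.inr e)) T₁,
    .inv (.ins y) T₂, .res (.ins y) T₂, .inv (.rem (.inl x)) T₂, .res (.rem (.inl x)) T₂,
    .res (.rem (.inr e)) T₁]

variable {x y : V} (e : E) {T₁ T₂ : I}

theorem isHistory_overlappedEmptyRemoval (hxy : x ≠ y) (hT : T₁ ≠ T₂) :
    IsHistory (overlappedEmptyRemoval x y e T₁ T₂) := by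
  apply isHistory_of_list
  · simp [overlappedEmptyRemoval, hxy]
  · simp [overlappedEmptyRemoval, hxy]
  · simp only [overlappedEmptyRemoval, occursBefore_cons, not_occursBefore_nil, List.mem_cons]
    grind
  · intro k
    by_cases h₁ : T₁ = k <;> by_cases h₂ : T₂ = k <;>
      simp_all [overlappedEmptyRemoval, threadEvents, Event.thread]

theorem histComplete_overlappedEmptyRemoval (x y : V) (T₁ T₂ : I) :
    HistComplete (overlappedEmptyRemoval x y e T₁ T₂) := by
  simp only [HistComplete, overlappedEmptyRemoval, List.mem_cons]
  grind

theorem threadInduced_overlappedEmptyRemoval_left (hxy : x ≠ y) (hT : T₁ ≠ T₂) :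
    threadInduced (overlappedEmptyRemoval x y e T₁ T₂) T₁ =
      [.inv (.ins x) T₁, .res (.ins x) T₁, .inv (.rem (.inr e)) T₁,
        .inv (.rem (.inl x)) T₂, .res (.rem (.inl x)) T₂, .res (.rem (.inr e)) T₁] := by
  simp [threadInduced, overlappedEmptyRemoval, hxy.symm, hT]

theorem threadInduced_overlappedEmptyRemoval_right (hxy : x ≠ y) (hT : T₁ ≠ T₂) :
    threadInduced (overlappedEmptyRemoval x y e T₁ T₂) T₂ =
      [.inv (.rem (.inr e)) T₁, .inv (.ins y) T₂, .res (.ins y) T₂,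
        .res (.rem (.inr e)) T₁] := by
  simp [threadInduced, overlappedEmptyRemoval, hxy, hT.symm]

theorem threadInduced_overlappedEmptyRemoval_of_ne {T : I} (h₁ : T ≠ T₁) (h₂ : T ≠ T₂) :
    threadInduced (overlappedEmptyRemoval x y e T₁ T₂) T =
      [.inv (.rem (.inr e)) T₁, .res (.rem (.inr e)) T₁] := by
  simp [threadInduced, overlappedEmptyRemoval, h₁, h₂]

theorem linearizable_threadInduced_left (hxy : x ≠ y) (hT : T₁ ≠ T₂) :
    Linearizable (poolSpec V E) (threadInduced (overlappedEmptyRemoval x y e T₁ T₂) T₁) := by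
  rw [threadInduced_overlappedEmptyRemoval_left e hxy hT]
  refine linearizable_of_histComplete (s := [.ins x, .rem (.inl x), .rem (.inr e)])
    (isHistory_of_list ?_ ?_ ?_ ?_) ?_ ?_ ?_ ?_
  · simp
  · simp
  · simp only [occursBefore_cons, not_occursBefore_nil, List.mem_cons]
    grind
  · intro k
    by_cases h₁ : T₁ = k <;> by_cases h₂ : T₂ = k <;>
      simp_all [threadEvents, Event.thread]
  · simp only [HistComplete, List.mem_cons]
    grind
  · simp [poolSpec]
  · simpa using List.Perm.swap _ _ _
  · simp only [occursBefore_cons, not_occursBefore_nil]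
    grind

theorem linearizable_threadInduced_right (hxy : x ≠ y) (hT : T₁ ≠ T₂) :
    Linearizable (poolSpec V E) (threadInduced (overlappedEmptyRemoval x y e T₁ T₂) T₂) := by
  rw [threadInduced_overlappedEmptyRemoval_right e hxy hT]
  refine linearizable_of_histComplete (s := [.rem (.inr e), .ins y])
    (isHistory_of_list ?_ ?_ ?_ ?_) ?_ ?_ ?_ ?_
  · simp
  · simp
  · simp only [occursBefore_cons, not_occursBefore_nil, List.mem_cons]
    grind
  · intro k
    by_cases h₁ : T₁ = k <;> by_cases h₂ : T₂ = k <;>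
      simp_all [threadEvents, Event.thread]
  · simp only [HistComplete, List.mem_cons]
    grind
  · simp [poolSpec]
  · simp
  · simp only [occursBefore_cons, not_occursBefore_nil]
    grind

theorem linearizable_threadInduced_of_ne {T : I} (h₁ : T ≠ T₁) (h₂ : T ≠ T₂) :
    Linearizable (poolSpec V E) (threadInduced (overlappedEmptyRemoval x y e T₁ T₂) T) := by
  rw [threadInduced_overlappedEmptyRemoval_of_ne e h₁ h₂]
  refine linearizable_of_histComplete (s := [.rem (.inr e)])
    (isHistory_of_list ?_ ?_ ?_ ?_) ?_ ?_ ?_ ?_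
  · simp
  · simp
  · simp only [occursBefore_cons, not_occursBefore_nil, List.mem_cons]
    grind
  · intro k
    by_cases h : T₁ = k <;> simp_all [threadEvents, Event.thread]
  · simp only [HistComplete, List.mem_cons]
    grind
  · simp [poolSpec]
  · simp
  · simp only [occursBefore_cons, not_occursBefore_nil]
    grind

theorem locallyLinearizable_overlappedEmptyRemoval (hxy : x ≠ y) (hT : T₁ ≠ T₂) :
    LocallyLinearizable (poolSpec V E) (overlappedEmptyRemoval x y e T₁ T₂) := by
  constructor
  · intro T
    by_cases h₁ : T = T₁
    · rw [h₁]
      exact linearizable_threadInduced_left e hxy hT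
    by_cases h₂ : T = T₂
    · rw [h₂]
      exact linearizable_threadInduced_right e hxy hT
    exact linearizable_threadInduced_of_ne e h₁ h₂
  · rintro m ⟨k, hk⟩
    rcases m with v | v | v
    · exact ⟨k, hk⟩
    · refine ⟨T₁, ?_⟩
      simp [overlappedEmptyRemoval] at hk
      simp [overlappedEmptyRemoval, hk.1]
    · exact ⟨k, trivial⟩

theorem not_seqConsistent_overlappedEmptyRemoval (hxy : x ≠ y) (hT : T₁ ≠ T₂) :
    ¬ SeqConsistent (poolSpec V E) (overlappedEmptyRemoval x y e T₁ T₂) := by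
  rintro ⟨hc, hcomp, s, ⟨hnd, -, hemp⟩, hp, ho⟩
  obtain rfl := hcomp.eq_of_histComplete (isHistory_overlappedEmptyRemoval e hxy hT).nodup
    (histComplete_overlappedEmptyRemoval e x y T₁ T₂)
  have hxe : OccursBefore s (.ins x) (.rem (.inr e)) :=
    ho _ _ (precedes_iff.mpr ⟨T₁, T₁, by simp [overlappedEmptyRemoval]⟩)
      ⟨T₁, by simp [overlappedEmptyRemoval]⟩
  have hyx : OccursBefore s (.ins y) (.rem (.inl x)) :=
    ho _ _ (precedes_iff.mpr ⟨T₂, T₂, by simp [overlappedEmptyRemoval]⟩)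
      ⟨T₂, by simp [overlappedEmptyRemoval]⟩
  have hy := (hemp e y (hyx.trans hnd (hemp e x hxe).2)).1
  simp [hp.mem_iff, overlappedEmptyRemoval, hxy.symm] at hy

end EmptyRemoval

/-- For pool, local linearizability is incomparable to sequential consistency. -/
theorem pool_locallyLinearizable_incomparable_seqConsistent
    (V E I : Type*) (x y : V) (hxy : x ≠ y) (e : E) (T₁ T₂ : I) (hT : T₁ ≠ T₂) :
    (∃ h : List (Event (CMethod V E) I), IsHistory h ∧
        SeqConsistent (poolSpec V E) h ∧
        ¬ LocallyLinearizable (poolSpec V E) h) ∧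
    (∃ h : List (Event (CMethod V E) I), IsHistory h ∧
        LocallyLinearizable (poolSpec V E) h ∧
        ¬ SeqConsistent (poolSpec V E) h) := by
  exact ⟨⟨removeBeforeInsert E x T₁ T₂, isHistory_removeBeforeInsert E x hT,
      seqConsistent_removeBeforeInsert E x hT, not_locallyLinearizable_removeBeforeInsert E x hT⟩,
    ⟨overlappedEmptyRemoval x y e T₁ T₂, isHistory_overlappedEmptyRemoval e hxy hT,
      locallyLinearizable_overlappedEmptyRemoval e hxy hT,
      not_seqConsistent_overlappedEmptyRemoval e hxy hT⟩⟩

end LL
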